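/- Let k be a positive integer with 1 ≤ k ≤ n/2. There exists a tight (k,k)-design in F_2^n, i.e. a (k,k)-design of cardinality ∑_{i=0}^k C(n−1,i), if and only if there exists a (2k+1)-design in F_2^n of cardinality 2·∑_{i=0}^k C(n−1,i) (a tight (2k+1)-design, attaining the Rao bound). -/

import Mathlib

open Finset

/-- The Krawtchouk polynomials `Q_i^{(n)}(t)`, determined by `Q_0 = 1`, `Q_1 = t` and the
three-term recurrence `n·t·Q_i(t) = (n−i)·Q_{i+1}(t) + i·Q_{i−1}(t)`. -/
noncomputable def kraw (n : ℕ) : ℕ → ℝ → ℝ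
  | 0, _ => 1
  | 1, t => t
  | (i+2), t =>
      ((n : ℝ) * t * kraw n (i+1) t - ((i : ℝ) + 1) * kraw n i t) / ((n : ℝ) - ((i : ℝ) + 1))

/-- The "inner product" `⟨x,y⟩ = 1 − 2 d(x,y)/n`. -/
noncomputable def ip (n : ℕ) (x y : Fin n → ZMod 2) : ℝ :=
  1 - 2 * (hammingDist x y : ℝ) / (n : ℝ)

/-- The `i`-th moment `M_i(C) = ∑_{x,y ∈ C} Q_i^{(n)}(⟨x,y⟩)`. -/
noncomputable def moment (n : ℕ) (C : Finset (Fin n → ZMod 2)) (i : ℕ) : ℝ :=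
  ∑ x ∈ C, ∑ y ∈ C, kraw n i (ip n x y)

/-- The antipodal (complement) point `−x`. -/
def antip {n : ℕ} (x : Fin n → ZMod 2) : Fin n → ZMod 2 := fun j => x j + 1

/-- `C` is a `(k,k)`-design: a nonempty code with `M_i(C) = 0` for all even `i` with `2 ≤ i ≤ 2k`. -/
def IsKKDesign (n k : ℕ) (C : Finset (Fin n → ZMod 2)) : Prop :=
  C.Nonempty ∧ ∀ j : ℕ, 1 ≤ j → j ≤ k → moment n C (2 * j) = 0

/-- `C` is an `m`-design: a nonempty code with `M_i(C) = 0` for all `1 ≤ i ≤ m`. -/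
def IsMDesign (n m : ℕ) (C : Finset (Fin n → ZMod 2)) : Prop :=
  C.Nonempty ∧ ∀ i : ℕ, 1 ≤ i → i ≤ m → moment n C i = 0

/-- Generalized binomial coefficient `C(z,j)` for real `z`. -/
noncomputable def gchoose (z : ℝ) (j : ℕ) : ℝ :=
  (∏ i ∈ Finset.range j, (z - (i : ℝ))) / (Nat.factorial j : ℝ)

/-- The Krawtchouk polynomial `K_i^{(m)}(z)` in the variable `z`. -/
noncomputable def krawK (m i : ℕ) (z : ℝ) : ℝ :=
  ∑ j ∈ Finset.range (i + 1), (-1 : ℝ) ^ j * gchoose z j * gchoose ((m : ℝ) - z) (i - j)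

/-- The adjacent polynomial `Q_i^{1,1}(t) = K_i^{(n−2)}(n(1−t)/2 − 1) / ∑_{j=0}^i C(n−1,j)`. -/
noncomputable def Q11 (n i : ℕ) (t : ℝ) : ℝ :=
  krawK (n - 2) i ((n : ℝ) * (1 - t) / 2 - 1) /
    (∑ j ∈ Finset.range (i + 1), ((n - 1).choose j : ℝ))


/-- Sign of a bit. -/
noncomputable def sgb (a : ZMod 2) : ℝ := if a = 0 then 1 else -1

lemma sgb_mul (a b : ZMod 2) : sgb a * sgb b = if a = b then 1 else -1 := by
  have h : ∀ c : ZMod 2, c = 0 ∨ c = 1 := by decide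
  rcases h a with rfl | rfl <;> rcases h b with rfl | rfl <;> simp [sgb]

lemma sgb_sq (a : ZMod 2) : sgb a * sgb a = 1 := by simp [sgb_mul]

lemma sgb_add_one (a : ZMod 2) : sgb (a + 1) = - sgb a := by
  have h : ∀ c : ZMod 2, c = 0 ∨ c = 1 := by decide
  have h2 : (1 : ZMod 2) + 1 = 0 := by decide
  rcases h a with rfl | rfl
  · simp [sgb]
  · rw [h2]; simp [sgb]

/-- Elementary symmetric sums. -/
noncomputable def esy {ι : Type*} [DecidableEq ι] (f : ι → ℝ) (s : Finset ι) (i : ℕ) : ℝ :=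
  ∑ t ∈ s.powersetCard i, ∏ j ∈ t, f j

lemma esy_zero {ι : Type*} [DecidableEq ι] (f : ι → ℝ) (s : Finset ι) : esy f s 0 = 1 := by
  simp [esy]

lemma esy_one {ι : Type*} [DecidableEq ι] (f : ι → ℝ) (s : Finset ι) :
    esy f s 1 = ∑ j ∈ s, f j := by
  simp [esy, Finset.powersetCard_one]

lemma esy_insert {ι : Type*} [DecidableEq ι] (f : ι → ℝ) (s : Finset ι) (a : ι) (ha : a ∉ s)
    (i : ℕ) : esy f (insert a s) (i + 1) = esy f s (i + 1) + f a * esy f s i := by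
  unfold esy
  rw [Finset.powersetCard_succ_insert ha, Finset.sum_union, Finset.sum_image, Finset.mul_sum]
  · congr 1
    refine Finset.sum_congr rfl fun t ht => ?_
    rw [Finset.prod_insert fun h => ha ((Finset.mem_powersetCard.1 ht).1 h)]
  · intro t ht u hu h
    have h1 : a ∉ t := fun h => ha ((Finset.mem_powersetCard.1 ht).1 h)
    have h2 : a ∉ u := fun h => ha ((Finset.mem_powersetCard.1 hu).1 h)
    rw [← Finset.erase_insert h1, ← Finset.erase_insert h2, h]
  · rw [Finset.disjoint_left]
    intro t ht ht'
    obtain ⟨u, hu, rfl⟩ := Finset.mem_image.1 ht'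
    exact ha ((Finset.mem_powersetCard.1 ht).1 (Finset.mem_insert_self _ _))

lemma esy_rec {ι : Type*} [DecidableEq ι] (f : ι → ℝ) (hf : ∀ j, f j * f j = 1) (s : Finset ι) :
    ∀ i : ℕ, (∑ j ∈ s, f j) * esy f s (i + 1)
      = ((i : ℝ) + 2) * esy f s (i + 2) + ((s.card : ℝ) - i) * esy f s i := by
  induction s using Finset.induction_on with
  | empty =>
    intro i
    have h0 : ∀ m, esy f ∅ (m + 1) = 0 := by
      intro m
      unfold esy
      rw [Finset.powersetCard_eq_empty.2 (by simp), Finset.sum_empty]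
    rcases i with _ | i
    · simp [h0 1]
    · rw [h0 i, h0 (i + 1 + 1)]; simp
  | insert a s ha ih =>
    intro i
    rw [Finset.sum_insert ha, Finset.card_insert_of_notMem ha, esy_insert f s a ha,
      esy_insert f s a ha (i + 1)]
    have h1 := ih i
    have h2 := hf a
    rcases i with _ | i
    · simp only [esy_zero] at h1 ⊢
      have h3 := esy_one f s
      push_cast at *
      simp only [zero_add] at *
      linear_combination h1 + h2 - f a * h3
    · rw [esy_insert f s a ha i]
      have h3 := ih i
      push_cast at *
      linear_combination h1 + h2 * esy f s (i + 1) + f a * h3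

lemma sum_sgb {n : ℕ} (hn : 0 < n) (x y : Fin n → ZMod 2) :
    ∑ j, sgb (x j) * sgb (y j) = n * ip n x y := by
  have h : (n : ℝ) ≠ 0 := by positivity
  have : (n : ℝ) * ip n x y = n - 2 * hammingDist x y := by
    unfold ip; field_simp
  rw [this]
  simp only [sgb_mul, hammingDist]
  have : ∀ j, (if x j = y j then (1 : ℝ) else -1) = 1 - 2 * (if x j ≠ y j then 1 else 0) := by
    intro j; split_ifs <;> simp_all <;> norm_num
  simp only [this, Finset.sum_sub_distrib, ← Finset.mul_sum, Finset.sum_boole]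
  simp

lemma choose_kraw {n : ℕ} (hn : 0 < n) (x y : Fin n → ZMod 2) : ∀ i : ℕ, i ≤ n →
    (n.choose i : ℝ) * kraw n i (ip n x y) = esy (fun j => sgb (x j) * sgb (y j)) univ i := by
  intro i
  induction i using Nat.twoStepInduction with
  | zero => intro _; simp [kraw, esy_zero]
  | one => intro _; rw [esy_one, sum_sgb hn]; simp [kraw]
  | more i h1 h2 =>
    intro hi
    have h1 := h1 (by omega)
    have h2 := h2 (by omega)
    have h3 := esy_rec (fun j => sgb (x j) * sgb (y j))
      (fun j => by linear_combination sgb_sq (x j) * sgb (y j) * sgb (y j) + sgb_sq (y j))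
      univ i
    rw [sum_sgb hn, ← h1, ← h2] at h3
    simp only [Finset.card_univ, Fintype.card_fin] at h3
    have hne : (n : ℝ) - ((i : ℝ) + 1) ≠ 0 := by
      have : (i : ℝ) + 2 ≤ n := by exact_mod_cast hi
      intro h; linarith
    have hk : kraw n (i + 2) (ip n x y) * ((n : ℝ) - ((i : ℝ) + 1)) =
      ((n : ℝ) * ip n x y * kraw n (i+1) (ip n x y) - ((i : ℝ) + 1) * kraw n i (ip n x y)) := by
      rw [kraw]; field_simp
    have c1 : (n.choose (i + 1) : ℝ) * (i + 1) = n.choose i * (n - i) := by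
      have := Nat.choose_succ_right_eq n i
      rw [← Nat.cast_sub (by omega : i ≤ n)]; exact_mod_cast this
    have c2 : (n.choose (i + 2) : ℝ) * (i + 2) = n.choose (i + 1) * (n - (i + 1)) := by
      have := Nat.choose_succ_right_eq n (i + 1)
      have h : (n : ℝ) - ((i : ℝ) + 1) = ((n - (i + 1) : ℕ) : ℝ) := by
        rw [Nat.cast_sub (by omega : i + 1 ≤ n)]; push_cast; ring
      rw [h]; exact_mod_cast this
    have : ((i : ℝ) + 2) ≠ 0 := by positivity
    apply mul_left_cancel₀ this
    linear_combination h3 + c2 * kraw n (i + 2) (ip n x y) + n.choose (i + 1) * hk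
      - c1 * kraw n i (ip n x y)

/-- Characters. -/
noncomputable def chr {n : ℕ} (S : Finset (Fin n)) (x : Fin n → ZMod 2) : ℝ := ∏ j ∈ S, sgb (x j)

lemma chr_symmDiff {n : ℕ} (S T : Finset (Fin n)) (x : Fin n → ZMod 2) :
    chr S x * chr T x = chr (symmDiff S T) x := by
  have h : ∀ U : Finset (Fin n), chr U x = ∏ j, if j ∈ U then sgb (x j) else 1 := by
    intro U; simp [chr, Finset.prod_ite_mem]
  rw [h, h, h, ← Finset.prod_mul_distrib]
  refine Finset.prod_congr rfl fun j _ => ?_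
  have := sgb_sq (x j)
  by_cases h1 : j ∈ S <;> by_cases h2 : j ∈ T <;> simp [Finset.mem_symmDiff, h1, h2, this]

lemma chr_sq {n : ℕ} (S : Finset (Fin n)) (x : Fin n → ZMod 2) : chr S x * chr S x = 1 := by
  rw [chr_symmDiff]; simp [chr]

lemma chr_antip {n : ℕ} (S : Finset (Fin n)) (x : Fin n → ZMod 2) :
    chr S (antip x) = (-1) ^ S.card * chr S x := by
  simp only [chr, antip, sgb_add_one]
  rw [Finset.prod_neg]

lemma choose_moment {n : ℕ} (hn : 0 < n) (C : Finset (Fin n → ZMod 2)) (i : ℕ) (hi : i ≤ n) :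
    (n.choose i : ℝ) * moment n C i
      = ∑ S ∈ (univ : Finset (Fin n)).powersetCard i, (∑ x ∈ C, chr S x) ^ 2 := by
  unfold moment
  simp only [Finset.mul_sum, choose_kraw hn _ _ i hi, esy, Finset.prod_mul_distrib]
  rw [Finset.sum_congr rfl fun x _ => Finset.sum_comm, Finset.sum_comm]
  refine Finset.sum_congr rfl fun S _ => ?_
  rw [sq, Finset.sum_mul_sum]
  rfl

lemma moment_zero_iff {n : ℕ} (hn : 0 < n) (C : Finset (Fin n → ZMod 2)) (i : ℕ) (hi : i ≤ n) :
    moment n C i = 0 ↔ ∀ S : Finset (Fin n), S.card = i → ∑ x ∈ C, chr S x = 0 := by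
  have hc : (n.choose i : ℝ) ≠ 0 := by exact_mod_cast (Nat.choose_pos hi).ne'
  rw [← mul_eq_zero_iff_left hc, choose_moment hn C i hi,
    Finset.sum_eq_zero_iff_of_nonneg (fun _ _ => sq_nonneg _)]
  simp [Finset.mem_powersetCard]

lemma kraw_top {n : ℕ} (hn : 0 < n) (t : ℝ) : kraw n (n + 1) t = 0 := by
  obtain ⟨m, rfl⟩ : ∃ m, n = m + 1 := ⟨n - 1, by omega⟩
  rw [kraw]; simp

/-- Index family. -/
def fam (n k : ℕ) : Finset (Finset (Fin n)) :=
  univ.filter fun S => S.card ≤ k ∧ S.card % 2 = k % 2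

lemma card_fam {n : ℕ} (hn : 0 < n) (k : ℕ) :
    (fam n k).card = ∑ i ∈ Finset.range (k + 1), (n - 1).choose i := by
  obtain ⟨m, rfl⟩ : ∃ m, n = m + 1 := ⟨n - 1, by omega⟩
  have hp : ∀ i, ((univ : Finset (Fin (m+1))).powersetCard i).card = (m+1).choose i := by simp
  induction k using Nat.twoStepInduction with
  | zero =>
    have : fam (m+1) 0 = (univ : Finset (Fin (m+1))).powersetCard 0 := by
      ext S; simp only [fam, mem_filter, mem_univ, true_and, mem_powersetCard, subset_univ]; omega
    rw [this, hp]; simp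
  | one =>
    have : fam (m+1) 1 = (univ : Finset (Fin (m+1))).powersetCard 1 := by
      ext S; simp only [fam, mem_filter, mem_univ, true_and, mem_powersetCard, subset_univ]; omega
    rw [this, hp]; simp [Finset.sum_range_succ, add_comm]
  | more k h1 _ =>
    have : fam (m+1) (k+2) = fam (m+1) k ∪ (univ : Finset (Fin (m+1))).powersetCard (k+2) := by
      ext S
      simp only [fam, mem_filter, mem_univ, true_and, mem_powersetCard, subset_univ, mem_union]
      omega
    rw [this, Finset.card_union_of_disjoint, hp, h1, Finset.sum_range_succ _ (k+2),
      Finset.sum_range_succ _ (k+1), Nat.choose_succ_succ]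
    · simp; ring
    · rw [Finset.disjoint_left]
      intro S
      simp only [fam, mem_filter, mem_univ, true_and, mem_powersetCard, subset_univ]
      omega

lemma card_sd {n : ℕ} (S T : Finset (Fin n)) :
    (symmDiff S T).card + 2 * (S ∩ T).card = S.card + T.card := by
  have h1 : (symmDiff S T).card = (S \ T).card + (T \ S).card := by
    rw [symmDiff_def]; exact Finset.card_union_of_disjoint disjoint_sdiff_sdiff
  have h2 := Finset.card_sdiff_add_card_inter S T
  have h3 := Finset.card_sdiff_add_card_inter T S
  rw [Finset.inter_comm] at h3
  omega

lemma tight_orth {n k : ℕ} (C : Finset (Fin n → ZMod 2)) (hC : C.Nonempty)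
    (h : ∀ S : Finset (Fin n), S.Nonempty → S.card % 2 = 0 → S.card ≤ 2 * k →
      ∑ x ∈ C, chr S x = 0)
    (hcard : C.card = (fam n k).card) (x y : Fin n → ZMod 2) (hx : x ∈ C) (hy : y ∈ C)
    (hxy : x ≠ y) : ∑ S ∈ fam n k, chr S x * chr S y = 0 := by
  classical
  have hc : (C.card : ℝ) ≠ 0 := by exact_mod_cast hC.card_pos.ne'
  let M : Matrix (fam n k) C ℝ := fun S x => chr S.1 x.1
  let N : Matrix C (fam n k) ℝ := fun x S => (C.card : ℝ)⁻¹ * chr S.1 x.1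
  have h1 : M * N = 1 := by
    ext S T
    rw [Matrix.mul_apply, Matrix.one_apply]
    have e : ∑ j : C, M S j * N j T = (C.card : ℝ)⁻¹ * ∑ x ∈ C, chr (symmDiff S.1 T.1) x := by
      rw [← Finset.sum_coe_sort C, Finset.mul_sum]
      refine Finset.sum_congr rfl fun j _ => ?_
      rw [← chr_symmDiff]; simp only [M, N]; ring
    rw [e]
    split_ifs with hST
    · subst hST
      simp [chr, hc]
    · rw [h, mul_zero]
      · rw [Finset.nonempty_iff_ne_empty]
        intro h0
        exact hST (Subtype.ext (symmDiff_eq_bot.1 h0))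
      · have := card_sd S.1 T.1
        have a := S.2; have b := T.2
        simp only [fam, mem_filter, mem_univ, true_and] at a b
        omega
      · have := card_sd S.1 T.1
        have a := S.2; have b := T.2
        simp only [fam, mem_filter, mem_univ, true_and] at a b
        omega
  have h2 : N * M = 1 := (Matrix.mul_eq_one_comm_of_card_eq _ _ _ (by simp [hcard])).1 h1
  have h3 := congrFun (congrFun h2 ⟨x, hx⟩) ⟨y, hy⟩
  rw [Matrix.mul_apply, Matrix.one_apply_ne (by simpa using hxy)] at h3
  have e : ∑ S : fam n k, N ⟨x, hx⟩ S * M S ⟨y, hy⟩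
      = (C.card : ℝ)⁻¹ * ∑ S ∈ fam n k, chr S x * chr S y := by
    rw [← Finset.sum_coe_sort (fam n k), Finset.mul_sum]
    refine Finset.sum_congr rfl fun j _ => ?_
    simp only [M, N]; ring
  rw [e] at h3
  exact (mul_eq_zero.1 h3).resolve_left (inv_ne_zero hc)

lemma antip_antip {n : ℕ} (x : Fin n → ZMod 2) : antip (antip x) = x := by
  funext j
  have : (1 : ZMod 2) + 1 = 0 := by decide
  simp [antip, add_assoc, this]

/-- tight `(k,k)`-designs exist iff tight `(2k+1)`-designs (attaining the
Rao bound) exist. -/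
theorem stmt_9 (n k : ℕ) (hn : 0 < n) (hk : 1 ≤ k) (hkn : 2 * k ≤ n) :
    (∃ C : Finset (Fin n → ZMod 2), IsKKDesign n k C ∧
        C.card = ∑ i ∈ Finset.range (k + 1), (n - 1).choose i) ↔
      (∃ D : Finset (Fin n → ZMod 2), IsMDesign n (2 * k + 1) D ∧
        D.card = 2 * ∑ i ∈ Finset.range (k + 1), (n - 1).choose i) := by
  classical
  have hinj : Function.Injective (antip : (Fin n → ZMod 2) → _) :=
    Function.LeftInverse.injective antip_antip
  rw [← card_fam hn k]
  constructor
  · rintro ⟨C, ⟨hne, hC⟩, hcard⟩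
    have h : ∀ S : Finset (Fin n), S.Nonempty → S.card % 2 = 0 → S.card ≤ 2 * k →
        ∑ x ∈ C, chr S x = 0 := by
      intro S hS h2 hle
      have hpos := hS.card_pos
      exact (moment_zero_iff hn C _ (by omega)).1 (hC (S.card / 2) (by omega) (by omega)) S
        (by omega)
    have hdis : Disjoint C (C.image antip) := by
      rw [Finset.disjoint_left]
      intro y hy hy'
      obtain ⟨x, hx, rfl⟩ := Finset.mem_image.1 hy'
      have hxy : x ≠ antip x := by
        intro h
        have := congrFun h ⟨0, hn⟩
        simp [antip] at this
      have h0 := tight_orth C hne h hcard x (antip x) hx hy hxy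
      have : ∑ S ∈ fam n k, chr S x * chr S (antip x) = (fam n k).card * (-1 : ℝ) ^ k := by
        rw [← nsmul_eq_mul, ← Finset.sum_const]
        refine Finset.sum_congr rfl fun S hS => ?_
        simp only [fam, mem_filter, mem_univ, true_and] at hS
        rw [chr_antip, neg_one_pow_eq_pow_mod_two, hS.2, ← neg_one_pow_eq_pow_mod_two]
        linear_combination (-1 : ℝ) ^ k * chr_sq S x
      rw [this, ← hcard] at h0
      have hc : (C.card : ℝ) ≠ 0 := by exact_mod_cast hne.card_pos.ne'
      exact mul_ne_zero hc (pow_ne_zero _ (by norm_num)) h0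
    refine ⟨C ∪ C.image antip, ⟨hne.mono Finset.subset_union_left, ?_⟩, ?_⟩
    · intro i h1 hi
      by_cases hin : i ≤ n
      · rw [moment_zero_iff hn _ _ hin]
        intro S hS
        rw [Finset.sum_union hdis, Finset.sum_image (fun _ _ _ _ h => hinj h)]
        simp only [chr_antip, ← Finset.mul_sum]
        rcases Nat.even_or_odd S.card with he | ho
        · rw [h S (Finset.card_pos.1 (by omega)) (Nat.even_iff.1 he)]
          · simp
          · have := Nat.even_iff.1 he
            omega
        · rw [ho.neg_one_pow]; ring
      · obtain rfl : i = n + 1 := by omega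
        simp [moment, kraw_top hn]
    · rw [Finset.card_union_of_disjoint hdis, Finset.card_image_of_injective _ hinj, hcard]; ring
  · rintro ⟨D, ⟨hne, hD⟩, hcard⟩
    have h : ∀ S : Finset (Fin n), S.Nonempty → S.card ≤ 2 * k + 1 → ∑ x ∈ D, chr S x = 0 := by
      intro S hS hle
      have : S.card ≤ n := by simpa using Finset.card_le_univ S
      exact (moment_zero_iff hn D _ this).1 (hD _ hS.card_pos hle) S rfl
    let z : Fin n := ⟨0, hn⟩
    have key : ∀ S : Finset (Fin n), 2 * ∑ x ∈ D.filter (fun x => x z = 0), chr S x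
        = ∑ x ∈ D, chr S x + ∑ x ∈ D, chr (symmDiff S {z}) x := by
      intro S
      rw [Finset.sum_filter, Finset.mul_sum, ← Finset.sum_add_distrib]
      refine Finset.sum_congr rfl fun x _ => ?_
      rw [← chr_symmDiff]
      have : chr {z} x = sgb (x z) := by simp [chr]
      rw [this, sgb]
      split_ifs <;> ring
    have hc : (D.filter (fun x => x z = 0)).card = (fam n k).card := by
      have h1 := key ∅
      rw [show symmDiff (∅ : Finset (Fin n)) {z} = {z} from bot_symmDiff _,
        h {z} (by simp) (by simp)] at h1
      simp only [chr, Finset.prod_empty, Finset.sum_const, nsmul_eq_mul, mul_one, add_zero] at h1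
      have h2 : 2 * (D.filter (fun x => x z = 0)).card = D.card := by exact_mod_cast h1
      omega
    refine ⟨D.filter (fun x => x z = 0), ⟨?_, ?_⟩, hc⟩
    · have := hne.card_pos
      exact Finset.card_pos.1 (by omega)
    · intro j hj hjk
      rw [moment_zero_iff hn _ _ (by omega)]
      intro S hS
      have h1 := key S
      have h2 := card_sd S {z}
      have h3 : (S ∩ {z}).card ≤ 1 := by
        simpa using Finset.card_le_card (Finset.inter_subset_right (s₁ := S) (s₂ := {z}))
      rw [Finset.card_singleton] at h2
      rw [h S (Finset.card_pos.1 (by omega)) (by omega),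
        h _ (Finset.card_pos.1 (by omega)) (by omega)] at h1
      linarith
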